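/- Let n ≥ 1 be an integer and let ξ = (ξ_0,…,ξ_n) ∈ ℝ^{n+1} be a point whose coordinates are linearly independent over ℚ. Then λ̂(ξ) + λ̂(ξ)²/λ(ξ) + ⋯ + λ̂(ξ)ⁿ/λ(ξ)^{n−1} ≤ 1, where the ratio λ̂(ξ)/λ(ξ) is interpreted as 0 when λ(ξ) = ∞; equivalently, if λ(ξ) < ∞ then ∑_{k=1}^{n} λ̂(ξ)^k / λ(ξ)^{k−1} ≤ 1, and if λ(ξ) = ∞ then λ̂(ξ) ≤ 1. -/

import Mathlib

open Filter

/-- Euclidean norm of an integer point of `ℤ^{n+1}`. -/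
noncomputable def inorm {n : ℕ} (x : Fin (n + 1) → ℤ) : ℝ :=
  Real.sqrt (∑ k, ((x k : ℝ)) ^ 2)

/-- `L_ξ(x) = max_{1 ≤ k ≤ n} |ξ₀ x_k − ξ_k x₀|` (the term `k = 0` vanishes, so the
maximum over all `k` agrees with the maximum over `1 ≤ k ≤ n` when `n ≥ 1`). -/
noncomputable def Lxi {n : ℕ} (ξ : Fin (n + 1) → ℝ) (x : Fin (n + 1) → ℤ) : ℝ :=
  Finset.univ.sup' Finset.univ_nonempty fun k => |ξ 0 * (x k : ℝ) - ξ k * (x 0 : ℝ)|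

/-- `𝓛_ξ(X; S) = min { L_ξ(x) : x ∈ S, 0 < ‖x‖ ≤ X }`, with the convention `min ∅ = ∞`. -/
noncomputable def calL {n : ℕ} (ξ : Fin (n + 1) → ℝ) (S : Set (Fin (n + 1) → ℤ)) (X : ℝ) :
    ENNReal :=
  sInf { l | ∃ x ∈ S, x ≠ 0 ∧ inorm x ≤ X ∧ l = ENNReal.ofReal (Lxi ξ x) }

/-- The ordinary exponent `λ(ξ; S) = sup { λ ≥ 0 : liminf_{X→∞} X^λ 𝓛_ξ(X;S) < ∞ }`,
as an extended nonnegative real. -/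
noncomputable def lamOrd {n : ℕ} (ξ : Fin (n + 1) → ℝ) (S : Set (Fin (n + 1) → ℤ)) : ENNReal :=
  sSup { l | ∃ t : ℝ, 0 ≤ t ∧ l = ENNReal.ofReal t ∧
    Filter.liminf (fun X : ℝ => ENNReal.ofReal (X ^ t) * calL ξ S X) Filter.atTop < ⊤ }

/-- The uniform exponent `λ̂(ξ; S) = sup { λ ≥ 0 : limsup_{X→∞} X^λ 𝓛_ξ(X;S) < ∞ }`. -/
noncomputable def lamHat {n : ℕ} (ξ : Fin (n + 1) → ℝ) (S : Set (Fin (n + 1) → ℤ)) : ENNReal :=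
  sSup { l | ∃ t : ℝ, 0 ≤ t ∧ l = ENNReal.ofReal t ∧
    Filter.limsup (fun X : ℝ => ENNReal.ofReal (X ^ t) * calL ξ S X) Filter.atTop < ⊤ }

open InnerProductSpace
/-- Gram matrix of the first k vectors -/
noncomputable def detGram {E : Type*} [NormedAddCommGroup E] [InnerProductSpace ℝ E] (y : ℕ → E) (k : ℕ) : ℝ :=
  (Matrix.of fun i j : Fin k => inner ℝ (y i) (y j)).det

lemma detGram_eq_prod {E : Type*} [NormedAddCommGroup E] [InnerProductSpace ℝ E] (y : ℕ → E) (k : ℕ) :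
    detGram y k = ∏ i ∈ Finset.range k, ‖gramSchmidt ℝ y i‖ ^ 2 := by
  classical
  set g := gramSchmidt ℝ y with hg
  let A : Matrix (Fin k) (Fin k) ℝ := Matrix.of fun i j =>
    if j = i then 1 else if j < i then inner ℝ (g j) (y i) / ‖g j‖ ^ 2 else 0
  have hA : ∀ i : Fin k, y i = ∑ j, A i j • g j := by
    intro i
    have h := gramSchmidt_def'' ℝ y (i : ℕ)
    rw [← hg] at h
    have h2 : ∑ j : Fin k, A i j • g j = ∑ j ∈ Finset.range k,
        (if j = i then (1:ℝ) else if j < i then inner ℝ (g j) (y i) / ‖g j‖ ^ 2 else 0) • g j := by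
      rw [Finset.sum_range]
      refine Finset.sum_congr rfl fun j _ => ?_
      simp [A, Fin.ext_iff]
    rw [h2, ← Finset.add_sum_erase _ _ (Finset.mem_range.2 i.2)]
    simp only [if_true, one_smul]
    conv_lhs => rw [h]
    congr 1
    rw [← Finset.sum_subset (s₁ := Finset.Iio (i:ℕ)) (s₂ := (Finset.range k).erase (i:ℕ))]
    · refine Finset.sum_congr rfl fun j hj => ?_
      have := Finset.mem_Iio.1 hj
      simp [this.ne, this]
    · intro j hj
      have := Finset.mem_Iio.1 hj
      have := i.2
      simp; omega
    · intro j hj hj'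
      simp at hj hj'
      simp [hj.1, show ¬ j < (i:ℕ) by omega]
  have hG : (Matrix.of fun i j : Fin k => inner ℝ (y i) (y j)) =
      A * Matrix.diagonal (fun i : Fin k => ‖g i‖ ^ 2) * A.transpose := by
    ext i j
    rw [Matrix.mul_apply]
    simp only [Matrix.of_apply, Matrix.mul_diagonal, Matrix.transpose_apply]
    rw [hA i, hA j, sum_inner]
    refine Finset.sum_congr rfl fun a _ => ?_
    rw [inner_sum, Finset.sum_eq_single a]
    · simp [inner_smul_left, inner_smul_right]; ring
    · intro b _ hb
      have : inner ℝ (g a) (g b) = 0 := gramSchmidt_orthogonal ℝ y (fun h => hb (Fin.ext h.symm))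
      simp [inner_smul_left, inner_smul_right, this]
    · simp
  have hdet : A.det = 1 := by
    rw [Matrix.det_of_isLowerTriangular A]
    · simp [A]
    · intro i j hij
      have : i < j := hij
      simp [A, this.ne', this.not_gt]
  rw [detGram, hG, Matrix.det_mul, Matrix.det_mul, Matrix.det_transpose, hdet, Matrix.det_diagonal, Finset.prod_range]
  simp

lemma detGram_succ_le {E : Type*} [NormedAddCommGroup E] [InnerProductSpace ℝ E] (y : ℕ → E) (k : ℕ)
    (w : E) (hw : w ∈ Submodule.span ℝ (y '' Set.Iio k)) :
    detGram y (k+1) ≤ detGram y k * ‖y k - w‖ ^ 2 := by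
  rw [detGram_eq_prod, detGram_eq_prod, Finset.prod_range_succ]
  refine mul_le_mul_of_nonneg_left ?_ (Finset.prod_nonneg fun _ _ => by positivity)
  set g := gramSchmidt ℝ y with hg
  have hgk : ∀ z ∈ Submodule.span ℝ (y '' Set.Iio k), inner ℝ (g k) z = 0 := by
    intro z hz
    rw [← span_gramSchmidt_Iio ℝ y k] at hz
    induction hz using Submodule.span_induction with
    | mem x hx =>
      obtain ⟨j, hj, rfl⟩ := hx
      exact gramSchmidt_orthogonal ℝ y (ne_of_gt hj)
    | zero => simp
    | add x y _ _ hx hy => rw [inner_add_right, hx, hy, add_zero]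
    | smul a x _ hx => rw [inner_smul_right, hx, mul_zero]
  have hd : y k - g k ∈ Submodule.span ℝ (y '' Set.Iio k) := by
    rw [hg, gramSchmidt_def]
    rw [sub_sub_cancel, ← span_gramSchmidt_Iio ℝ y k]
    refine Submodule.sum_mem _ fun i hi => ?_
    refine Submodule.span_mono ?_ (Submodule.starProjection_apply_mem _ _)
    rintro _ rfl
    exact ⟨i, by simpa using hi, rfl⟩
  have : y k - w = g k + (y k - g k - w) := by abel
  rw [this, sq, sq, norm_add_sq_eq_norm_sq_add_norm_sq_of_inner_eq_zero _ _ (hgk _ (Submodule.sub_mem _ hd hw))]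
  nlinarith [mul_self_nonneg ‖y k - g k - w‖]

lemma detGram_succ_pos {E : Type*} [NormedAddCommGroup E] [InnerProductSpace ℝ E] (y : ℕ → E) (k : ℕ)
    (h0 : 0 < detGram y k) (hw : y k ∉ Submodule.span ℝ (y '' Set.Iio k)) :
    0 < detGram y (k+1) := by
  rw [detGram_eq_prod] at h0 ⊢
  rw [Finset.prod_range_succ]
  refine mul_pos h0 ?_
  have : gramSchmidt ℝ y k ≠ 0 := by
    intro h
    apply hw
    have h2 := gramSchmidt_def'' ℝ y k
    rw [h, zero_add] at h2
    rw [h2, ← span_gramSchmidt_Iio ℝ y k]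
    refine Submodule.sum_mem _ fun i hi => Submodule.smul_mem _ _ (Submodule.subset_span ⟨i, by simpa using hi, rfl⟩)
  positivity

lemma detGram_congr {E : Type*} [NormedAddCommGroup E] [InnerProductSpace ℝ E] (y z : ℕ → E) (k : ℕ)
    (h : ∀ i < k, y i = z i) : detGram y k = detGram z k := by
  unfold detGram
  congr 1
  ext i j
  simp [h i i.2, h j j.2]

noncomputable def toE {n : ℕ} (x : Fin (n+1) → ℤ) : EuclideanSpace ℝ (Fin (n+1)) :=
  WithLp.toLp 2 fun i => (x i : ℝ)

lemma one_le_detGram {n : ℕ} (y : ℕ → Fin (n+1) → ℤ) (k : ℕ)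
    (h : 0 < detGram (fun i => toE (y i)) k) : 1 ≤ detGram (fun i => toE (y i)) k := by
  have : detGram (fun i => toE (y i)) k =
    (((Matrix.of fun i j : Fin k => ∑ l, y i l * y j l).det : ℤ) : ℝ) := by
    rw [detGram, Int.cast_det]
    congr 1
    ext i j
    simp [toE, PiLp.inner_apply, mul_comm]
  rw [this] at h ⊢
  exact_mod_cast h

lemma step_bound {D Ck C a u v e α s : ℝ} (hCk : 0 < Ck) (hC : 0 < C)
    (ha : 1 ≤ a) (hau : a ≤ u) (hv : 1 ≤ v) (he0 : 0 ≤ e) (he1 : e ≤ 1)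
    (hD : D ≤ (Ck * a ^ e) ^ 2) (d : ℝ) (hd0 : 0 ≤ d) (hd : d ≤ C * v ^ (1 - α) / u)
    (hs : v ^ s ≤ C * u) :
    D * d ^ 2 ≤ (Ck * C * C ^ (1 - e) * v ^ (1 - α + s * (e - 1))) ^ 2 := by
  have hu : 0 < u := by linarith
  have hv0 : 0 < v := by linarith
  have h1 : a ^ e ≤ u ^ e := Real.rpow_le_rpow (by linarith) hau he0
  have h2 : u ^ e / u = u ^ (e - 1) := by rw [Real.rpow_sub_one hu.ne']
  have h3 : u ^ (e - 1) ≤ C ^ (1 - e) * v ^ (s * (e - 1)) := by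
    have h4 : (C * u) ^ (e - 1) ≤ (v ^ s) ^ (e - 1) :=
      Real.rpow_le_rpow_of_nonpos (by positivity) hs (by linarith)
    rw [Real.mul_rpow hC.le hu.le, ← Real.rpow_mul hv0.le] at h4
    have h5 : C ^ (1 - e) * C ^ (e - 1) = 1 := by
      rw [← Real.rpow_add hC]; simp
    calc u ^ (e - 1) = C ^ (1 - e) * (C ^ (e - 1) * u ^ (e - 1)) := by
          rw [← mul_assoc, h5, one_mul]
      _ ≤ _ := mul_le_mul_of_nonneg_left h4 (by positivity)
  have h6 : Ck * a ^ e * d ≤ Ck * C * C ^ (1 - e) * v ^ (1 - α + s * (e - 1)) := by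
    calc Ck * a ^ e * d ≤ Ck * u ^ e * (C * v ^ (1 - α) / u) := by
          gcongr
      _ = Ck * C * v ^ (1 - α) * (u ^ e / u) := by ring
      _ ≤ Ck * C * v ^ (1 - α) * (C ^ (1 - e) * v ^ (s * (e - 1))) := by
          rw [h2]; gcongr
      _ = _ := by rw [Real.rpow_add hv0]; ring
  calc D * d ^ 2 ≤ (Ck * a ^ e) ^ 2 * d ^ 2 := by gcongr
    _ = (Ck * a ^ e * d) ^ 2 := by ring
    _ ≤ _ := by gcongr

lemma core {n : ℕ} (m : ℕ → Fin (n+1) → ℤ) (α s C : ℝ) (hα : 0 < α) (hs : 0 ≤ s)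
    (hC : 0 < C) (N0 : ℕ)
    (hne : ∀ N, 1 ≤ ‖toE (m N)‖)
    (hmono : Monotone fun N => ‖toE (m N)‖)
    (hinf : ∀ B : ℝ, ∃ N, B ≤ ‖toE (m N)‖)
    (hexit : ∀ (y : ℕ → Fin (n+1) → ℤ) (k : ℕ), k ≤ n → ∀ M, ∃ N ≥ M,
      toE (m N) ∉ Submodule.span ℝ ((fun i => toE (y i)) '' Set.Iio k))
    (hstep : ∀ N ≥ N0, m (N+1) = m N ∨
      ((∃ r : ℝ, ‖toE (m (N+1)) - r • toE (m N)‖ ≤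
          C * ‖toE (m (N+1))‖ ^ (1 - α) / ‖toE (m N)‖) ∧
        ‖toE (m (N+1))‖ ^ s ≤ C * ‖toE (m N)‖)) :
    α * ∑ i ∈ Finset.range n, s ^ i ≤ 1 := by
  classical
  set e : ℕ → ℝ := fun k => 1 - α * ∑ i ∈ Finset.range k, s ^ i with he
  have hesucc : ∀ k, e (k+1) = 1 - α + s * (e k - 1) := by
    intro k; simp only [he, geom_sum_succ]; ring
  have hele : ∀ k, e k ≤ 1 := by
    intro k
    have : 0 ≤ α * ∑ i ∈ Finset.range k, s ^ i := by positivity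
    simp only [he]; linarith
  have claim : ∀ k ≤ n, (∀ j < k, 0 ≤ e j) → ∃ Ck > 0, ∀ M ≥ N0,
      ∃ (y : ℕ → Fin (n+1) → ℤ) (N : ℕ), N ≥ M ∧ y k = m N ∧
        0 < detGram (fun i => toE (y i)) (k+1) ∧
        detGram (fun i => toE (y i)) (k+1) ≤ (Ck * ‖toE (y k)‖ ^ e k) ^ 2 := by
    intro k
    induction k with
    | zero =>
      intro _ _
      refine ⟨1, one_pos, fun M _ => ⟨fun _ => m M, M, le_rfl, rfl, ?_⟩⟩
      have h1 : detGram (fun _ : ℕ => toE (m M)) (0+1) = ‖toE (m M)‖ ^ 2 := by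
        simp [detGram]
      have := hne M
      rw [h1]
      refine ⟨by positivity, by simp [he]⟩
    | succ k ih =>
      intro hk hpos
      obtain ⟨Ck, hCk, H⟩ := ih (by omega) (fun j hj => hpos j (by omega))
      refine ⟨Ck * C * C ^ (1 - e k), by positivity, fun M hM => ?_⟩
      obtain ⟨y, N, hN, hyk, hd0, hd⟩ := H M hM
      set W := Submodule.span ℝ ((fun i => toE (y i)) '' Set.Iio (k+1)) with hW
      have hNW : toE (m N) ∈ W := by
        rw [← hyk]; exact Submodule.subset_span ⟨k, by simp, rfl⟩
      have hex : ∃ j, toE (m (N + j)) ∉ W := by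
        obtain ⟨N', hN', h⟩ := hexit y (k+1) hk N
        exact ⟨N' - N, by rwa [Nat.add_sub_cancel' hN']⟩
      obtain ⟨j, hj1, hj2⟩ : ∃ j, toE (m (N + j)) ∈ W ∧ toE (m (N + j + 1)) ∉ W := by
        have h0 : Nat.find hex ≠ 0 := by
          intro h0
          have := Nat.find_spec hex
          rw [h0] at this
          exact this hNW
        obtain ⟨j, hj⟩ := Nat.exists_eq_succ_of_ne_zero h0
        refine ⟨j, ?_, ?_⟩
        · have := Nat.find_min hex (m := j) (by omega)
          simpa using this
        · have := Nat.find_spec hex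
          rw [hj] at this
          exact this
      set u := toE (m (N + j)) with hu
      set v := toE (m (N + j + 1)) with hv
      have hne' : m (N + j + 1) ≠ m (N + j) := by
        intro h
        rw [hv, h] at hj2
        exact hj2 hj1
      obtain ⟨⟨r, hr⟩, hsv⟩ := (hstep (N + j) (by omega)).resolve_left hne'
      let y' : ℕ → Fin (n+1) → ℤ := fun i => if i ≤ k then y i else m (N + j + 1)
      have hy' : ∀ i < k + 1, toE (y' i) = toE (y i) := by
        intro i hi
        simp [y', show i ≤ k by omega]
      have hy'k : y' (k+1) = m (N + j + 1) := by simp [y']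
      have hspan : Submodule.span ℝ ((fun i => toE (y' i)) '' Set.Iio (k+1)) = W := by
        rw [hW]; congr 1
        exact Set.image_congr fun i hi => hy' i hi
      have hcong : detGram (fun i => toE (y' i)) (k+1) = detGram (fun i => toE (y i)) (k+1) :=
        detGram_congr _ _ _ hy'
      refine ⟨y', N + j + 1, by omega, hy'k, ?_, ?_⟩
      · apply detGram_succ_pos
        · rwa [hcong]
        · rw [hspan, hy'k]; exact hj2
      · have h1 := detGram_succ_le (fun i => toE (y' i)) (k+1) (r • u)
          (by rw [hspan]; exact Submodule.smul_mem _ _ hj1)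
        refine h1.trans ?_
        rw [hcong, hy'k, hesucc]
        refine step_bound (a := ‖toE (y k)‖) hCk hC ?_ ?_ (hne _) (hpos k (by omega))
          (hele k) hd _ (norm_nonneg _) hr hsv
        · rw [hyk]; exact hne _
        · rw [hyk]; exact hmono (by omega)
  by_contra hcon
  have hen : ∃ k, e k < 0 := ⟨n, by simp only [he]; linarith⟩
  have hkn : Nat.find hen ≤ n := Nat.find_min' hen (by simp only [he]; linarith)
  have hk := Nat.find_spec hen
  obtain ⟨Ck, hCk, H⟩ := claim _ hkn (fun j hj => not_lt.1 (Nat.find_min hen hj))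
  set k := Nat.find hen
  have hlim : Filter.Tendsto (fun x : ℝ => Ck * x ^ e k) Filter.atTop (nhds 0) := by
    have := (tendsto_rpow_neg_atTop (y := - e k) (by linarith)).const_mul Ck
    simpa using this
  obtain ⟨B, hB⟩ := Filter.eventually_atTop.1 (hlim.eventually_lt_const one_pos)
  obtain ⟨N1, hN1⟩ := hinf B
  obtain ⟨y, N, hN, hyk, hd0, hd⟩ := H (max N0 N1) (le_max_left _ _)
  have h1 := one_le_detGram y _ hd0
  have h2 := hB ‖toE (y k)‖ (by
    rw [hyk]; exact hN1.trans (hmono (le_trans (le_max_right _ _) hN)))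
  have h3 : 0 ≤ Ck * ‖toE (y k)‖ ^ e k := by positivity
  nlinarith

def nsq {n : ℕ} (x : Fin (n+1) → ℤ) : ℤ := ∑ k, x k ^ 2

lemma inorm_eq {n : ℕ} (x : Fin (n+1) → ℤ) : inorm x = ‖toE x‖ := by
  simp [inorm, toE, EuclideanSpace.norm_eq]

lemma inorm_sq {n : ℕ} (x : Fin (n+1) → ℤ) : inorm x ^ 2 = (nsq x : ℝ) := by
  rw [inorm, Real.sq_sqrt (by positivity), nsq]; push_cast; rfl

lemma one_le_inorm {n : ℕ} (x : Fin (n+1) → ℤ) (hx : x ≠ 0) : 1 ≤ inorm x := by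
  have h : 0 < nsq x := by
    obtain ⟨k, hk⟩ := Function.ne_iff.1 hx
    have hk' : x k ≠ 0 := hk
    have h1 : x k ^ 2 ≤ nsq x :=
      Finset.single_le_sum (f := fun k => x k ^ 2) (fun _ _ => sq_nonneg _) (Finset.mem_univ k)
    have : 0 < x k ^ 2 := by positivity
    omega
  have h2 : (1:ℝ) ≤ inorm x ^ 2 := by rw [inorm_sq]; exact_mod_cast h
  have : 0 ≤ inorm x := Real.sqrt_nonneg _
  nlinarith

lemma abs_le_Lxi {n : ℕ} (ξ : Fin (n + 1) → ℝ) (x : Fin (n + 1) → ℤ) (k : Fin (n+1)) :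
    |ξ 0 * (x k : ℝ) - ξ k * (x 0 : ℝ)| ≤ Lxi ξ x :=
  Finset.le_sup' (fun k => |ξ 0 * (x k : ℝ) - ξ k * (x 0 : ℝ)|) (Finset.mem_univ k)

lemma Lxi_nonneg {n : ℕ} (ξ : Fin (n + 1) → ℝ) (x : Fin (n + 1) → ℤ) : 0 ≤ Lxi ξ x :=
  (abs_nonneg _).trans (abs_le_Lxi ξ x 0)

lemma exists_min {n : ℕ} (ξ : Fin (n + 1) → ℝ) (N : ℕ) :
    ∃ x : Fin (n+1) → ℤ, x ≠ 0 ∧ nsq x ≤ N + 1 ∧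
      ∀ z : Fin (n+1) → ℤ, z ≠ 0 → nsq z ≤ N + 1 → Lxi ξ x ≤ Lxi ξ z := by
  let S : Set (Fin (n+1) → ℤ) := {x | x ≠ 0 ∧ nsq x ≤ N + 1}
  have hfin : S.Finite := by
    refine (Set.finite_Icc (fun _ : Fin (n+1) => -((N:ℤ)+1)) (fun _ => (N:ℤ)+1)).subset ?_
    rintro x ⟨_, hx⟩
    have h : ∀ k, x k ^ 2 ≤ N + 1 := fun k => le_trans
      (Finset.single_le_sum (f := fun k => x k ^ 2) (fun _ _ => sq_nonneg _) (Finset.mem_univ k)) hx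
    refine ⟨fun k => ?_, fun k => ?_⟩
    · have := h k; show -((N:ℤ)+1) ≤ x k; nlinarith
    · have := h k; show x k ≤ (N:ℤ)+1; nlinarith
  have hne : S.Nonempty := by
    refine ⟨Pi.single 0 1, ?_, ?_⟩
    · simp
    · have : nsq (Pi.single (0 : Fin (n+1)) (1:ℤ)) = 1 := by
        simp [nsq, Pi.single_apply]
      rw [this]; omega
  obtain ⟨x, hx, h⟩ := Set.exists_min_image S (Lxi ξ) hfin hne
  exact ⟨x, hx.1, hx.2, fun z h1 h2 => h z ⟨h1, h2⟩⟩

lemma exists_seq {n : ℕ} (ξ : Fin (n + 1) → ℝ) :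
    ∃ m : ℕ → Fin (n+1) → ℤ, (∀ N, m N ≠ 0 ∧ nsq (m N) ≤ N + 1 ∧
      ∀ z : Fin (n+1) → ℤ, z ≠ 0 → nsq z ≤ N + 1 → Lxi ξ (m N) ≤ Lxi ξ z) ∧
      ∀ N, m (N+1) = m N ∨ nsq (m (N+1)) = N + 2 := by
  classical
  choose a ha0 ha1 ha2 using exists_min ξ
  let m : ℕ → Fin (n+1) → ℤ := fun N => Nat.rec (a 0)
    (fun N x => if Lxi ξ x ≤ Lxi ξ (a (N+1)) then x else a (N+1)) N
  have hm : ∀ N, m (N+1) = if Lxi ξ (m N) ≤ Lxi ξ (a (N+1)) then m N else a (N+1) :=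
    fun N => rfl
  have hP : ∀ N, m N ≠ 0 ∧ nsq (m N) ≤ N + 1 ∧
      ∀ z : Fin (n+1) → ℤ, z ≠ 0 → nsq z ≤ N + 1 → Lxi ξ (m N) ≤ Lxi ξ z := by
    intro N
    induction N with
    | zero => exact ⟨ha0 0, ha1 0, ha2 0⟩
    | succ N ih =>
      rw [hm]
      split_ifs with h
      · refine ⟨ih.1, by push_cast; linarith [ih.2.1], fun z hz hz' => h.trans (ha2 (N+1) z hz hz')⟩
      · exact ⟨ha0 _, ha1 _, ha2 _⟩
  refine ⟨m, hP, fun N => ?_⟩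
  rw [hm]
  split_ifs with h
  · left; rfl
  · right
    have h1 := ha1 (N+1)
    push_cast at h1
    by_contra h2
    exact h ((hP N).2.2 _ (ha0 _) (by omega))

lemma exit_lemma {n : ℕ} (ξ : Fin (n + 1) → ℝ) (hξ : LinearIndependent ℚ ξ)
    (m : ℕ → Fin (n+1) → ℤ) (hm0 : ∀ N, m N ≠ 0)
    (hL : Filter.Tendsto (fun N => Lxi ξ (m N)) Filter.atTop (nhds 0))
    (y : ℕ → Fin (n+1) → ℤ) (k : ℕ) (hk : k ≤ n) (M : ℕ) :
    ∃ N ≥ M, toE (m N) ∉ Submodule.span ℝ ((fun i => toE (y i)) '' Set.Iio k) := by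
  have hξ0 : ξ 0 ≠ 0 := hξ.ne_zero 0
  obtain ⟨c, hc0, hc⟩ : ∃ c : Fin (n+1) → ℚ, c ≠ 0 ∧ ∀ i < k, ∑ j, c j * (y i j : ℚ) = 0 := by
    let A : Matrix (Fin k) (Fin (n+1)) ℚ := Matrix.of fun i j => (y i j : ℚ)
    have h : LinearMap.ker A.mulVecLin ≠ ⊥ := LinearMap.ker_ne_bot_of_finrank_lt (by simp; omega)
    obtain ⟨c, hc, hc0⟩ := (Submodule.ne_bot_iff _).1 h
    refine ⟨c, hc0, fun i hi => ?_⟩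
    have := congrFun (LinearMap.mem_ker.1 hc) ⟨i, hi⟩
    simpa [A, Matrix.mulVec, dotProduct, mul_comm] using this
  set l : ℝ := ∑ j, (c j : ℝ) * ξ j with hl
  have hl0 : l ≠ 0 := by
    intro h
    apply hc0
    have := Fintype.linearIndependent_iff.1 hξ c (by simpa [hl, Rat.smul_def] using h)
    exact funext this
  have hW : ∀ w ∈ Submodule.span ℝ ((fun i => toE (y i)) '' Set.Iio k),
      ∑ j, (c j : ℝ) * w j = 0 := by
    intro w hw
    induction hw using Submodule.span_induction with
    | mem x hx =>
      obtain ⟨i, hi, rfl⟩ := hx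
      have := hc i hi
      simp only [toE]
      exact_mod_cast this
    | zero => simp
    | add x y _ _ hx hy => simp [mul_add, Finset.sum_add_distrib, hx, hy]
    | smul a x _ hx =>
      have : ∑ j, (c j : ℝ) * (a • x) j = a * ∑ j, (c j : ℝ) * x j := by
        rw [Finset.mul_sum]; refine Finset.sum_congr rfl fun j _ => ?_
        simp; ring
      rw [this, hx, mul_zero]
  set K : ℝ := ∑ j, |(c j : ℝ)| with hK
  have hK0 : 0 ≤ K := by positivity
  have hl1 : 0 < |l| := abs_pos.2 hl0
  have hev := (hL.eventually_lt_const (abs_pos.2 hξ0)).and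
    (hL.eventually_lt_const (show 0 < |l| / (K + 1) by positivity))
  obtain ⟨N1, hN1⟩ := Filter.eventually_atTop.1 hev
  refine ⟨max M N1, le_max_left _ _, fun hmem => ?_⟩
  obtain ⟨h1, h2⟩ := hN1 (max M N1) (le_max_right _ _)
  set x := m (max M N1) with hx
  have h3 : ∑ j, (c j : ℝ) * (x j : ℝ) = 0 := hW _ hmem
  have h4 : (x 0 : ℝ) * l = - ∑ j, (c j : ℝ) * (ξ 0 * (x j : ℝ) - ξ j * (x 0 : ℝ)) := by
    have : ∑ j, (c j : ℝ) * (ξ 0 * (x j : ℝ) - ξ j * (x 0 : ℝ)) =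
        ξ 0 * ∑ j, (c j : ℝ) * (x j : ℝ) - x 0 * l := by
      rw [hl, Finset.mul_sum, Finset.mul_sum, ← Finset.sum_sub_distrib]
      refine Finset.sum_congr rfl fun j _ => by ring
    rw [this, h3]; ring
  have h5 : |(x 0 : ℝ)| * |l| ≤ K * Lxi ξ x := by
    rw [← abs_mul, h4, abs_neg, hK, Finset.sum_mul]
    refine (Finset.abs_sum_le_sum_abs _ _).trans (Finset.sum_le_sum fun j _ => ?_)
    rw [abs_mul]
    exact mul_le_mul_of_nonneg_left (abs_le_Lxi ξ x j) (abs_nonneg _)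
  have hx0 : x 0 = 0 := by
    by_contra hne
    have : (1:ℝ) ≤ |(x 0 : ℝ)| := by exact_mod_cast Int.one_le_abs hne
    rw [lt_div_iff₀ (by positivity)] at h2
    have := Lxi_nonneg ξ x
    nlinarith
  apply hm0 (max M N1)
  rw [← hx]
  funext j
  by_contra hne
  have h6 := abs_le_Lxi ξ x j
  rw [hx0] at h6
  have : (1:ℝ) ≤ |(x j : ℝ)| := by exact_mod_cast Int.one_le_abs hne
  simp [abs_mul] at h6
  have := abs_nonneg (ξ 0)
  nlinarith

/-- Bound for the distance from `v` to the line spanned by `u`. -/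
lemma dist_bound {n : ℕ} (ξ : Fin (n + 1) → ℝ) (hξ0 : ξ 0 ≠ 0) :
    ∃ C > 0, ∃ δ > 0, ∀ u v : Fin (n+1) → ℤ, u ≠ 0 → Lxi ξ u < δ → Lxi ξ v ≤ Lxi ξ u →
      inorm u ≤ inorm v → ∃ r : ℝ, ‖toE v - r • toE u‖ ≤ C * (inorm v * Lxi ξ u) / inorm u := by
  set X : EuclideanSpace ℝ (Fin (n+1)) := WithLp.toLp 2 ξ with hX
  have hz : 0 < |ξ 0| := abs_pos.2 hξ0
  set K : ℝ := (n + 1) / |ξ 0| with hK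
  have hKpos : 0 < K := by positivity
  have hco : ∀ (x : Fin (n+1) → ℤ) , |(x 0 : ℝ)| ≤ inorm x := by
    intro x
    rw [inorm_eq]
    exact PiLp.norm_apply_le (toE x) 0
  have key : ∀ x : Fin (n+1) → ℤ, ‖toE x - ((x 0 : ℝ) / ξ 0) • X‖ ≤ K * Lxi ξ x := by
    intro x
    have hb : ∀ j, |(toE x - ((x 0 : ℝ) / ξ 0) • X) j| ≤ Lxi ξ x / |ξ 0| := by
      intro j
      have : (toE x - ((x 0 : ℝ) / ξ 0) • X) j = (ξ 0 * (x j : ℝ) - ξ j * (x 0 : ℝ)) / ξ 0 := by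
        simp [toE, X]; field_simp
      rw [this, abs_div]
      gcongr
      exact abs_le_Lxi ξ x j
    have h0 : 0 ≤ Lxi ξ x / |ξ 0| := div_nonneg (Lxi_nonneg _ _) hz.le
    rw [EuclideanSpace.norm_eq, Real.sqrt_le_left (by have := Lxi_nonneg ξ x; positivity)]
    calc ∑ j, ‖(toE x - ((x 0 : ℝ) / ξ 0) • X) j‖ ^ 2
        ≤ ∑ j : Fin (n+1), (Lxi ξ x / |ξ 0|) ^ 2 := by
          refine Finset.sum_le_sum fun j _ => ?_
          rw [Real.norm_eq_abs]
          exact pow_le_pow_left₀ (abs_nonneg _) (hb j) 2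
      _ = (n + 1) * (Lxi ξ x / |ξ 0|) ^ 2 := by simp
      _ ≤ (n + 1) ^ 2 * (Lxi ξ x / |ξ 0|) ^ 2 := by
          gcongr
          have : (0:ℝ) ≤ n := by positivity
          nlinarith
      _ = (K * Lxi ξ x) ^ 2 := by rw [hK]; ring
  have hXn : 0 < ‖X‖ := by
    rw [norm_pos_iff]
    intro h
    apply hξ0
    have := congrArg (fun z : EuclideanSpace ℝ (Fin (n+1)) => z 0) h
    simpa [X] using this
  set Q : ℝ := ‖X‖ / |ξ 0| with hQ
  have hQpos : 0 < Q := by positivity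
  refine ⟨K + K * (2 * Q), by positivity, 1 / (2 * K), by positivity, ?_⟩
  intro u v hu hδ hvu huv
  have hu1 := one_le_inorm u hu
  have hLu := Lxi_nonneg ξ u
  have hLv := Lxi_nonneg ξ v
  have hKL : K * Lxi ξ u ≤ 1 / 2 := by
    rw [lt_div_iff₀ (by positivity)] at hδ
    nlinarith
  have h1 : inorm u / 2 ≤ |(u 0 : ℝ)| * Q := by
    have h2 : ‖toE u‖ ≤ ‖toE u - ((u 0 : ℝ) / ξ 0) • X‖ + ‖((u 0 : ℝ) / ξ 0) • X‖ := by
      simpa using norm_add_le (toE u - ((u 0 : ℝ) / ξ 0) • X) (((u 0 : ℝ) / ξ 0) • X)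
    have h3 : ‖((u 0 : ℝ) / ξ 0) • X‖ = |(u 0 : ℝ)| * Q := by
      rw [norm_smul, Real.norm_eq_abs, abs_div, hQ]; ring
    have := key u
    rw [← inorm_eq] at h2
    linarith
  have hu0 : 0 < |(u 0 : ℝ)| := by
    by_contra h
    have : |(u 0 : ℝ)| * Q ≤ 0 := mul_nonpos_of_nonpos_of_nonneg (not_lt.1 h) hQpos.le
    linarith
  have hu0' : (u 0 : ℝ) ≠ 0 := abs_pos.1 hu0
  refine ⟨(v 0 : ℝ) / u 0, ?_⟩
  have hdec : toE v - ((v 0 : ℝ) / u 0) • toE u =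
      (toE v - ((v 0 : ℝ) / ξ 0) • X) - ((v 0 : ℝ) / u 0) • (toE u - ((u 0 : ℝ) / ξ 0) • X) := by
    rw [smul_sub, smul_smul, show (v 0 : ℝ) / u 0 * ((u 0 : ℝ) / ξ 0) = (v 0 : ℝ) / ξ 0 by
      field_simp]
    abel
  have hr : |(v 0 : ℝ) / u 0| ≤ 2 * Q * (inorm v / inorm u) := by
    rw [abs_div, div_le_iff₀ hu0]
    have h5 := hco v
    have h6 : 1 ≤ 2 * (|(u 0 : ℝ)| * Q) / inorm u := by
      rw [le_div_iff₀ (by linarith)]; linarith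
    calc |(v 0 : ℝ)| ≤ inorm v * 1 := by linarith
      _ ≤ inorm v * (2 * (|(u 0 : ℝ)| * Q) / inorm u) := by
        gcongr; linarith
      _ = _ := by ring
  have h7 : 1 ≤ inorm v / inorm u := by rw [le_div_iff₀ (by linarith)]; linarith
  calc ‖toE v - ((v 0 : ℝ) / u 0) • toE u‖
      ≤ ‖toE v - ((v 0 : ℝ) / ξ 0) • X‖ +
        ‖((v 0 : ℝ) / u 0) • (toE u - ((u 0 : ℝ) / ξ 0) • X)‖ := by
        rw [hdec]; exact norm_sub_le _ _
    _ ≤ K * Lxi ξ v + |(v 0 : ℝ) / u 0| * (K * Lxi ξ u) := by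
        rw [norm_smul, Real.norm_eq_abs]
        have := key u
        have := key v
        gcongr
    _ ≤ K * (inorm v / inorm u * Lxi ξ u) + 2 * Q * (inorm v / inorm u) * (K * Lxi ξ u) := by
        gcongr
        nlinarith
    _ = _ := by ring

lemma main_ineq {n : ℕ} (hn : 1 ≤ n) (ξ : Fin (n + 1) → ℝ) (hξ : LinearIndependent ℚ ξ)
    (t s : ℝ) (ht : 0 < t)
    (hlim : Filter.limsup (fun X : ℝ => ENNReal.ofReal (X ^ t) * calL ξ Set.univ X)
      Filter.atTop < ⊤)
    (hs : s = 0 ∨ ∃ β > 0, s = t / β ∧ ∀ᶠ X : ℝ in Filter.atTop,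
      1 ≤ ENNReal.ofReal (X ^ β) * calL ξ Set.univ X) :
    t * ∑ i ∈ Finset.range n, s ^ i ≤ 1 := by
  have hξ0 : ξ 0 ≠ 0 := hξ.ne_zero 0
  obtain ⟨m, hm, hchange⟩ := exists_seq ξ
  have hm0 : ∀ N, m N ≠ 0 := fun N => (hm N).1
  have hsq : Filter.Tendsto (fun N : ℕ => Real.sqrt ((N:ℝ) + 1)) Filter.atTop Filter.atTop :=
    Real.tendsto_sqrt_atTop.comp
      (Filter.tendsto_atTop_add_const_right _ 1 tendsto_natCast_atTop_atTop)
  -- upper bound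
  obtain ⟨A, hA0, hA⟩ : ∃ A > (0:ℝ), ∀ᶠ N : ℕ in Filter.atTop,
      Real.sqrt ((N:ℝ) + 1) ^ t * Lxi ξ (m N) ≤ A := by
    obtain ⟨A, hA1, hA2⟩ := exists_between hlim
    have h1 := hsq.eventually (Filter.eventually_lt_of_limsup_lt hA1)
    refine ⟨A.toReal + 1, by positivity, ?_⟩
    filter_upwards [h1] with N hN
    set X := Real.sqrt ((N:ℝ) + 1) with hX
    have h2 : ENNReal.ofReal (Lxi ξ (m N)) ≤ calL ξ Set.univ X := by
      refine le_sInf ?_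
      rintro _ ⟨z, -, hz0, hz, rfl⟩
      apply ENNReal.ofReal_le_ofReal
      refine (hm N).2.2 z hz0 ?_
      have h3 : inorm z ^ 2 ≤ X ^ 2 := pow_le_pow_left₀ (Real.sqrt_nonneg _) hz 2
      rw [hX, Real.sq_sqrt (by positivity), inorm_sq] at h3
      exact_mod_cast h3
    have h4 : ENNReal.ofReal (X ^ t * Lxi ξ (m N)) ≤ A := by
      rw [ENNReal.ofReal_mul (by positivity)]
      exact (mul_le_mul_right h2 _).trans hN.le
    have := (ENNReal.ofReal_le_iff_le_toReal hA2.ne).1 h4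
    linarith
  have hL : Filter.Tendsto (fun N => Lxi ξ (m N)) Filter.atTop (nhds 0) := by
    have h1 : Filter.Tendsto (fun N : ℕ => A * Real.sqrt ((N:ℝ) + 1) ^ (-t)) Filter.atTop (nhds 0) := by
      have := ((tendsto_rpow_neg_atTop ht).comp hsq).const_mul A
      simpa using this
    refine tendsto_of_tendsto_of_tendsto_of_le_of_le' tendsto_const_nhds h1
      (Filter.Eventually.of_forall fun N => Lxi_nonneg _ _) ?_
    filter_upwards [hA] with N hN
    have hp : 0 < Real.sqrt ((N:ℝ) + 1) := by positivity
    rw [Real.rpow_neg hp.le, ← div_eq_mul_inv, le_div_iff₀ (by positivity)]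
    linarith
  have hexit := exit_lemma ξ hξ m hm0 hL
  have hne : ∀ N, 1 ≤ ‖toE (m N)‖ := fun N => by rw [← inorm_eq]; exact one_le_inorm _ (hm0 N)
  have hchange' : ∀ N, m (N+1) = m N ∨ inorm (m (N+1)) = Real.sqrt ((N:ℝ) + 2) := by
    intro N
    refine (hchange N).imp_right fun h => ?_
    have h0 : 0 ≤ inorm (m (N+1)) := Real.sqrt_nonneg _
    rw [← Real.sqrt_sq h0, inorm_sq, h]
    push_cast; rfl
  have hle : ∀ N, inorm (m N) ≤ Real.sqrt ((N:ℝ) + 1) := by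
    intro N
    apply Real.le_sqrt_of_sq_le
    rw [inorm_sq]
    exact_mod_cast (hm N).2.1
  have hmono : Monotone fun N => ‖toE (m N)‖ := by
    refine monotone_nat_of_le_succ fun N => ?_
    rw [← inorm_eq, ← inorm_eq]
    rcases hchange' N with h | h
    · rw [h]
    · rw [h]
      exact (hle N).trans (Real.sqrt_le_sqrt (by linarith))
  have hinf : ∀ B : ℝ, ∃ N, B ≤ ‖toE (m N)‖ := by
    intro B
    obtain ⟨M, hM⟩ := (hsq.eventually_ge_atTop B).exists_forall_of_atTop
    have : ∃ N ≥ M, m (N+1) ≠ m N := by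
      by_contra hcon
      push Not at hcon
      have hconst : ∀ N ≥ M, m N = m M := by
        intro N hN
        induction N, hN using Nat.le_induction with
        | base => rfl
        | succ N hN ih => rw [hcon N hN, ih]
      obtain ⟨N, hN, h⟩ := hexit (fun _ => m M) 1 hn M
      apply h
      rw [hconst N hN]
      exact Submodule.subset_span ⟨0, by simp, rfl⟩
    obtain ⟨N, hN, h⟩ := this
    refine ⟨N+1, ?_⟩
    rw [← inorm_eq, (hchange' N).resolve_left h]
    exact (hM N hN).trans (Real.sqrt_le_sqrt (by linarith))
  have hinf' : Filter.Tendsto (fun N => inorm (m N)) Filter.atTop Filter.atTop := by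
    have := Filter.tendsto_atTop_atTop_of_monotone hmono hinf
    simpa only [← inorm_eq] using this
  obtain ⟨C0, hC0, δ, hδ, hdist⟩ := dist_bound ξ hξ0
  set B : ℝ := 2 ^ t * A with hB
  have hBpos : 0 < B := by positivity
  -- bound with the new norm
  have hB1 : ∀ᶠ N : ℕ in Filter.atTop, m (N+1) = m N ∨
      inorm (m (N+1)) ^ t * Lxi ξ (m N) ≤ B := by
    filter_upwards [hA] with N hN
    refine (hchange' N).imp_right fun h => ?_
    have h1 : inorm (m (N+1)) ≤ 2 * Real.sqrt ((N:ℝ) + 1) := by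
      rw [h]
      apply Real.sqrt_le_iff.2 ⟨by positivity, ?_⟩
      rw [mul_pow, Real.sq_sqrt (by positivity)]
      have : (0:ℝ) ≤ N := by positivity
      linarith
    have h2 : inorm (m (N+1)) ^ t ≤ 2 ^ t * Real.sqrt ((N:ℝ) + 1) ^ t := by
      rw [← Real.mul_rpow (by norm_num) (Real.sqrt_nonneg _)]
      exact Real.rpow_le_rpow (Real.sqrt_nonneg _) h1 ht.le
    calc inorm (m (N+1)) ^ t * Lxi ξ (m N)
        ≤ 2 ^ t * Real.sqrt ((N:ℝ) + 1) ^ t * Lxi ξ (m N) :=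
          mul_le_mul_of_nonneg_right h2 (Lxi_nonneg _ _)
      _ = 2 ^ t * (Real.sqrt ((N:ℝ) + 1) ^ t * Lxi ξ (m N)) := by ring
      _ ≤ _ := by rw [hB]; gcongr
  -- lower bound
  obtain ⟨C2, hC2, hlow⟩ : ∃ C2 > (0:ℝ), ∀ᶠ N : ℕ in Filter.atTop, m (N+1) = m N ∨
      inorm (m (N+1)) ^ s ≤ C2 * inorm (m N) := by
    rcases hs with hs | ⟨β, hβ, hs, hev⟩
    · refine ⟨1, one_pos, Filter.Eventually.of_forall fun N => Or.inr ?_⟩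
      rw [hs, Real.rpow_zero, one_mul]
      exact one_le_inorm _ (hm0 N)
    · refine ⟨B ^ (1 / β), by positivity, ?_⟩
      filter_upwards [hB1, hinf'.eventually hev] with N h1 h2
      refine h1.imp_right fun h1 => ?_
      set u := inorm (m N) with hu
      set v := inorm (m (N+1)) with hv
      have hu1 : 1 ≤ u := one_le_inorm _ (hm0 N)
      have hv1 : 1 ≤ v := one_le_inorm _ (hm0 _)
      have h3 : calL ξ Set.univ u ≤ ENNReal.ofReal (Lxi ξ (m N)) :=
        sInf_le ⟨m N, trivial, hm0 N, le_rfl, rfl⟩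
      have h4 : 1 ≤ u ^ β * Lxi ξ (m N) := by
        have h5 := h2.trans (mul_le_mul_right h3 _)
        rw [← ENNReal.ofReal_mul (by positivity)] at h5
        exact ENNReal.one_le_ofReal.1 h5
      have h6 : v ^ t ≤ B * u ^ β := by
        calc v ^ t = v ^ t * 1 := by ring
          _ ≤ v ^ t * (u ^ β * Lxi ξ (m N)) := by gcongr
          _ = (v ^ t * Lxi ξ (m N)) * u ^ β := by ring
          _ ≤ B * u ^ β := by gcongr
      have h7 := Real.rpow_le_rpow (by positivity) h6 (show 0 ≤ 1 / β by positivity)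
      rw [Real.mul_rpow hBpos.le (by positivity), ← Real.rpow_mul (by positivity),
        ← Real.rpow_mul (by positivity), mul_one_div, mul_one_div, div_self hβ.ne',
        Real.rpow_one, ← hs] at h7
      exact h7
  obtain ⟨N0, hN0⟩ := Filter.eventually_atTop.1 (hB1.and (hlow.and (hL.eventually_lt_const hδ)))
  have hs0 : 0 ≤ s := by
    rcases hs with hs | ⟨β, hβ, hs, -⟩
    · exact hs.ge
    · rw [hs]; positivity
  refine core m t s (C0 * B + C2) ht hs0 (by positivity) N0 hne hmono hinf hexit ?_
  intro N hN
  obtain ⟨h1, h2, h3⟩ := hN0 N hN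
  by_cases h : m (N+1) = m N
  · exact Or.inl h
  right
  replace h1 := h1.resolve_left h
  replace h2 := h2.resolve_left h
  have hu1 : 1 ≤ inorm (m N) := one_le_inorm _ (hm0 N)
  have hv1 : 1 ≤ inorm (m (N+1)) := one_le_inorm _ (hm0 _)
  have huv : inorm (m N) ≤ inorm (m (N+1)) := by
    rw [inorm_eq, inorm_eq]; exact hmono (Nat.le_succ N)
  obtain ⟨r, hr⟩ := hdist (m N) (m (N+1)) (hm0 N) h3
    ((hm (N+1)).2.2 _ (hm0 N) (by have := (hm N).2.1; push_cast; omega)) huv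
  rw [← inorm_eq, ← inorm_eq]
  set u := inorm (m N)
  set v := inorm (m (N+1))
  refine ⟨⟨r, hr.trans ?_⟩, h2.trans ?_⟩
  · have h8 : v * Lxi ξ (m N) ≤ B * v ^ (1 - t) := by
      have : v = v ^ (1 - t) * v ^ t := by
        rw [← Real.rpow_add (by linarith)]; simp
      calc v * Lxi ξ (m N) = v ^ (1 - t) * (v ^ t * Lxi ξ (m N)) := by
            rw [← mul_assoc, ← this]
        _ ≤ v ^ (1 - t) * B := by gcongr
        _ = _ := by ring
    have h9 : 0 ≤ C2 * v ^ (1 - t) := by positivity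
    have h10 : C0 * (v * Lxi ξ (m N)) ≤ C0 * (B * v ^ (1 - t)) := by gcongr
    refine div_le_div_of_nonneg_right ?_ (by linarith)
    linarith
  · have : 0 ≤ C0 * B := by positivity
    nlinarith

lemma lamHat_le_one {n : ℕ} (hn : 1 ≤ n) (ξ : Fin (n + 1) → ℝ) (hξ : LinearIndependent ℚ ξ) :
    lamHat ξ Set.univ ≤ 1 := by
  refine sSup_le ?_
  rintro _ ⟨t, ht, rfl, hlim⟩
  rw [ENNReal.ofReal_le_one]
  rcases ht.eq_or_lt with h | h
  · rw [← h]; norm_num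
  · have := main_ineq hn ξ hξ t 0 h hlim (Or.inl rfl)
    have h2 : ∑ i ∈ Finset.range n, (0:ℝ) ^ i = 1 := by
      obtain ⟨k, rfl⟩ := Nat.exists_eq_add_of_le' hn
      simp [geom_sum_succ]
    rw [h2] at this
    linarith

lemma sum_eq (n : ℕ) (a b : ℝ) : ∑ k ∈ Finset.Icc 1 n, a ^ k / b ^ (k - 1) =
    a * ∑ i ∈ Finset.range n, (a / b) ^ i := by
  have : Finset.Icc 1 n = Finset.Ico 1 (n+1) := by ext; simp
  rw [this, Finset.sum_Ico_eq_sum_range, Finset.mul_sum]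
  refine Finset.sum_congr (by simp) fun i _ => ?_
  rw [Nat.add_sub_cancel_left, div_pow, pow_add, pow_one]; ring

lemma finite_case {n : ℕ} (hn : 1 ≤ n) (ξ : Fin (n + 1) → ℝ) (hξ : LinearIndependent ℚ ξ)
    (hfin : lamOrd ξ Set.univ < ⊤) :
    ∑ k ∈ Finset.Icc 1 n,
        (lamHat ξ Set.univ).toReal ^ k / (lamOrd ξ Set.univ).toReal ^ (k - 1) ≤ 1 := by
  have hhat := lamHat_le_one hn ξ hξ
  have hhat_ne : lamHat ξ Set.univ ≠ ⊤ := ne_top_of_le_ne_top ENNReal.one_ne_top hhat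
  rw [sum_eq]
  set h := (lamHat ξ Set.univ).toReal with hh
  set l := (lamOrd ξ Set.univ).toReal with hl
  have hh0 : 0 ≤ h := ENNReal.toReal_nonneg
  have hl0 : 0 ≤ l := ENNReal.toReal_nonneg
  have hh1 : h ≤ 1 := by
    have := ENNReal.toReal_mono ENNReal.one_ne_top hhat
    simpa using this
  rcases hh0.eq_or_lt with h0 | hpos
  · rw [← h0]; simp
  rcases hl0.eq_or_lt with h0 | hlpos
  · have h2 : ∑ i ∈ Finset.range n, (0:ℝ) ^ i = 1 := by
      obtain ⟨k, rfl⟩ := Nat.exists_eq_add_of_le' hn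
      simp [geom_sum_succ]
    rw [← h0, div_zero, h2]; linarith
  have key : ∀ ε : ℝ, 0 < ε → ε < h →
      (h - ε) * ∑ i ∈ Finset.range n, ((h - ε) / (l + ε)) ^ i ≤ 1 := by
    intro ε hε hεh
    have h1 : ENNReal.ofReal (h - ε) < lamHat ξ Set.univ := by
      rw [ENNReal.ofReal_lt_iff_lt_toReal (by linarith) hhat_ne]; linarith
    obtain ⟨_, ⟨t, ht, rfl, hlim⟩, h2⟩ := lt_sSup_iff.1 h1
    have ht' : h - ε < t := (ENNReal.ofReal_lt_ofReal_iff_of_nonneg (by linarith)).1 h2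
    have hβ : ∀ᶠ X : ℝ in Filter.atTop,
        1 ≤ ENNReal.ofReal (X ^ (l + ε)) * calL ξ Set.univ X := by
      have h3 : ¬ Filter.liminf (fun X : ℝ => ENNReal.ofReal (X ^ (l + ε)) * calL ξ Set.univ X)
          Filter.atTop < ⊤ := by
        intro h4
        have h5 : ENNReal.ofReal (l + ε) ≤ lamOrd ξ Set.univ :=
          le_sSup ⟨l + ε, by linarith, rfl, h4⟩
        rw [ENNReal.ofReal_le_iff_le_toReal hfin.ne] at h5
        linarith
      rw [not_lt, top_le_iff] at h3
      have h6 := Filter.eventually_lt_of_lt_liminf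
        (show (1 : ENNReal) < Filter.liminf
          (fun X : ℝ => ENNReal.ofReal (X ^ (l + ε)) * calL ξ Set.univ X) Filter.atTop by
            rw [h3]; exact ENNReal.one_lt_top)
      exact h6.mono fun X hX => hX.le
    have := main_ineq hn ξ hξ t (t / (l + ε)) (by linarith) hlim
      (Or.inr ⟨l + ε, by linarith, rfl, hβ⟩)
    refine le_trans ?_ this
    have : 0 ≤ h - ε := by linarith
    gcongr
  have hcont : Filter.Tendsto
      (fun ε : ℝ => (h - ε) * ∑ i ∈ Finset.range n, ((h - ε) / (l + ε)) ^ i)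
      (nhdsWithin 0 (Set.Ioi 0)) (nhds (h * ∑ i ∈ Finset.range n, (h / l) ^ i)) := by
    have h1 : ContinuousAt
        (fun ε : ℝ => (h - ε) * ∑ i ∈ Finset.range n, ((h - ε) / (l + ε)) ^ i) 0 := by
      have : l + 0 ≠ 0 := by simpa using hlpos.ne'
      fun_prop (disch := assumption)
    have h2 := h1.tendsto
    simp only [sub_zero, add_zero] at h2
    exact h2.mono_left nhdsWithin_le_nhds
  refine le_of_tendsto hcont ?_
  filter_upwards [Ioo_mem_nhdsGT hpos] with ε hε
  exact key ε hε.1 hε.2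

/-- Marnat–Moshchevitin inequality: for `ξ ∈ ℝ^{n+1}` with `ℚ`-linearly independent
coordinates, `λ̂ + λ̂²/λ + ⋯ + λ̂ⁿ/λ^{n−1} ≤ 1`, the ratio `λ̂/λ` being interpreted
as `0` when `λ = ∞` (in which case the inequality reads `λ̂ ≤ 1`). -/
theorem marnat_moshchevitin (n : ℕ) (hn : 1 ≤ n) (ξ : Fin (n + 1) → ℝ)
    (hξ : LinearIndependent ℚ ξ) :
    (lamOrd ξ Set.univ < ⊤ →
      ∑ k ∈ Finset.Icc 1 n,
        (lamHat ξ Set.univ).toReal ^ k / (lamOrd ξ Set.univ).toReal ^ (k - 1) ≤ 1) ∧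
    (lamOrd ξ Set.univ = ⊤ → lamHat ξ Set.univ ≤ 1) := by
  exact ⟨finite_case hn ξ hξ, fun _ => lamHat_le_one hn ξ hξ⟩
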